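/- arXiv:0801.3691 — 2 statements merged into one kernel-verified Lean document; each statement's English description precedes it below -/
import Mathlib

section
/- (Proposition 2.1, conditional form.) Suppose ε > 0 is such that the hyperbolic balls of radius ε centered at distinct points of the orbit Γ·i are pairwise disjoint, i.e. for all δ₁, δ₂ ∈ Γ with δ₁·i ≠ δ₂·i one has dist(δ₁·i, δ₂·i) > 2ε, where i ∈ ℍ is the point with re = 0 and im = 1. Then for every z ∈ ℍ with im z < 1 and every t ≥ 0, the set A(z,t) is finite and its cardinality satisfies Π(z,t) ≤ (e^ε/(2·(Real.sinh (ε/2))²))·e^t. -/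
open scoped UpperHalfPlane MatrixGroups
open UpperHalfPlane

noncomputable section

/-- The parabolic element `T = [[1,1],[0,1]]` of `SL(2,ℝ)`, acting on `ℍ` by `z ↦ z + 1`. -/
def T : SL(2, ℝ) := ⟨!![1, 1; 0, 1], by norm_num [Matrix.det_fin_two_of]⟩

/-- The horocycle segment `h ⊆ ℍ`: points with `-1/2 ≤ re < 1/2` and `im = 1`. -/
def horocycle : Set ℍ := {w : ℍ | -(1 / 2) ≤ w.re ∧ w.re < 1 / 2 ∧ w.im = 1}

variable (Γ : Subgroup SL(2, ℝ))

/-- The cyclic subgroup `Γ∞` of `Γ` generated by `T`. -/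
abbrev GammaInf (hT : T ∈ Γ) : Subgroup Γ := Subgroup.zpowers ⟨T, hT⟩

/-- The set of right cosets `Γ∞\Γ`. -/
abbrev Cosets (hT : T ∈ Γ) := Quotient (QuotientGroup.rightRel (GammaInf Γ hT))

variable (hT : T ∈ Γ)

/-- The term `(im (δ·z))^s` of the Eisenstein series attached to a coset `q ∈ Γ∞\Γ`
(`δ` a representative of `q`; the value is independent of the representative). -/
def eisTerm (z : ℍ) (s : ℝ) (q : Cosets Γ hT) : ℝ :=
  (((Quotient.out q : Γ) : SL(2, ℝ)) • z).im ^ s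

/-- The Eisenstein series `E(z,s) = ∑'_{q ∈ Γ∞\Γ} (im (δ·z))^s`. -/
def Eis (z : ℍ) (s : ℝ) : ℝ := ∑' q : Cosets Γ hT, eisTerm Γ hT z s q

/-- `A(z,t)`: the set of cosets `q ∈ Γ∞\Γ` admitting a representative `δ` with
`dist(i, δ·z) ≤ t`. -/
def Aset (z : ℍ) (t : ℝ) : Set (Cosets Γ hT) :=
  {q | ∃ δ : Γ, Quotient.mk (QuotientGroup.rightRel (GammaInf Γ hT)) δ = q ∧
    dist UpperHalfPlane.I ((δ : SL(2, ℝ)) • z) ≤ t}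

/-- `A(h,z,t)`: the set of cosets `q ∈ Γ∞\Γ` admitting a representative `δ` with
`-1/2 ≤ re(δ·z) < 1/2` and `infDist (δ·z) h ≤ t`. -/
def Ahset (z : ℍ) (t : ℝ) : Set (Cosets Γ hT) :=
  {q | ∃ δ : Γ, Quotient.mk (QuotientGroup.rightRel (GammaInf Γ hT)) δ = q ∧
    -(1 / 2) ≤ ((δ : SL(2, ℝ)) • z).re ∧ ((δ : SL(2, ℝ)) • z).re < 1 / 2 ∧
    Metric.infDist ((δ : SL(2, ℝ)) • z) horocycle ≤ t}

/-- The translation matrix `[[1,x],[0,1]]`. -/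
def translation (x : ℝ) : SL(2, ℝ) := ⟨!![1, x; 0, 1], by norm_num [Matrix.det_fin_two_of]⟩

lemma SL2_mul_apply (g h : SL(2, ℝ)) (i j : Fin 2) :
    (g * h) i j = g i 0 * h 0 j + g i 1 * h 1 j := by
  rw [Matrix.SpecialLinearGroup.coe_mul, Matrix.mul_apply, Fin.sum_univ_two]

lemma SL2_inv_apply (g : SL(2, ℝ)) :
    g⁻¹ 0 0 = g 1 1 ∧ g⁻¹ 0 1 = -g 0 1 ∧ g⁻¹ 1 0 = -g 1 0 ∧ g⁻¹ 1 1 = g 0 0 := by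
  rw [Matrix.SpecialLinearGroup.SL2_inv_expl]
  exact ⟨rfl, rfl, rfl, rfl⟩

lemma translation_apply (x : ℝ) :
    translation x 0 0 = 1 ∧ translation x 0 1 = x ∧ translation x 1 0 = 0 ∧
      translation x 1 1 = 1 :=
  ⟨rfl, rfl, rfl, rfl⟩

lemma T_eq_translation : T = translation 1 := rfl

lemma eq_translation {g : SL(2, ℝ)} {x : ℝ} (h₀₀ : g 0 0 = 1) (h₀₁ : g 0 1 = x)
    (h₁₀ : g 1 0 = 0) (h₁₁ : g 1 1 = 1) : g = translation x := by
  ext i j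
  fin_cases i <;> fin_cases j <;> simpa [translation]

lemma translation_mul (x y : ℝ) : translation x * translation y = translation (x + y) := by
  apply eq_translation <;> simp [SL2_mul_apply, translation_apply, add_comm]

lemma T_zpow (n : ℤ) : T ^ n = translation n := by
  have h0 : translation 0 = 1 := by
    ext i j
    fin_cases i <;> fin_cases j <;> simp [translation]
  induction n using Int.induction_on with
  | zero => simp [h0]
  | succ n ih => rw [zpow_add_one, ih, T_eq_translation, translation_mul]; push_cast; rfl
  | pred n ih =>
    rw [zpow_sub_one, ih, mul_inv_eq_iff_eq_mul, T_eq_translation, translation_mul]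
    push_cast
    ring_nf

/-- The squared Frobenius norm of a matrix in `SL(2,ℝ)`. -/
def frobeniusSq (g : SL(2, ℝ)) : ℝ := g 0 0 ^ 2 + g 0 1 ^ 2 + g 1 0 ^ 2 + g 1 1 ^ 2

lemma det_entries (g : SL(2, ℝ)) : g 0 0 * g 1 1 - g 0 1 * g 1 0 = 1 := by
  rw [← Matrix.det_fin_two, g.det_coe]

lemma two_mul_cosh_dist_I (g : SL(2, ℝ)) :
    2 * Real.cosh (dist UpperHalfPlane.I (g • UpperHalfPlane.I)) = frobeniusSq g := by
  have hdet := det_entries g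
  have hpos : 0 < g 1 0 ^ 2 + g 1 1 ^ 2 := by
    by_contra! h
    have h1 : g 1 0 = 0 := by nlinarith [sq_nonneg (g 1 0), sq_nonneg (g 1 1)]
    have h2 : g 1 1 = 0 := by nlinarith [sq_nonneg (g 1 0), sq_nonneg (g 1 1)]
    simp [h1, h2] at hdet
  have hne : g 1 1 ^ 2 + g 1 0 ^ 2 ≠ 0 := by rw [add_comm]; exact hpos.ne'
  have hre : (g • UpperHalfPlane.I).re =
      (g 0 0 * g 1 0 + g 0 1 * g 1 1) / (g 1 0 ^ 2 + g 1 1 ^ 2) := by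
    rw [← UpperHalfPlane.coe_re, UpperHalfPlane.specialLinearGroup_apply]
    simp [Complex.div_re, Complex.normSq_apply]
    simp only [← sq]
    field_simp
    ring
  have him : (g • UpperHalfPlane.I).im = 1 / (g 1 0 ^ 2 + g 1 1 ^ 2) := by
    rw [← UpperHalfPlane.coe_im, UpperHalfPlane.specialLinearGroup_apply]
    simp [Complex.div_im, Complex.normSq_apply]
    simp only [← sq]
    field_simp
    linear_combination (g 1 0 ^ 2 + g 1 1 ^ 2) * hdet
  rw [UpperHalfPlane.cosh_dist, Complex.dist_eq, ← Complex.normSq_eq_norm_sq,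
    Complex.normSq_apply]
  simp only [Complex.sub_re, Complex.sub_im, UpperHalfPlane.coe_re, UpperHalfPlane.coe_im, hre,
    him, UpperHalfPlane.I_re, UpperHalfPlane.I_im, frobeniusSq]
  set D := g 1 0 ^ 2 + g 1 1 ^ 2 with hD
  have key : (g 0 0 * g 1 0 + g 0 1 * g 1 1) ^ 2 + 1
      = (g 0 0 ^ 2 + g 0 1 ^ 2) * D := by
    rw [hD]
    linear_combination (-(g 0 0 * g 1 1 - g 0 1 * g 1 0) - 1) * hdet
  field_simp
  linear_combination key

/-- Shimizu's lemma. -/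
lemma one_le_abs_lower_left {Γ : Subgroup SL(2, ℝ)} {K : ℝ} (hK : 2 < K) (hT : T ∈ Γ)
    (hΓ : ∀ g ∈ Γ, frobeniusSq g = 2 ∨ K < frobeniusSq g) {g : SL(2, ℝ)} (hg : g ∈ Γ)
    (hc : g 1 0 ≠ 0) : 1 ≤ |g 1 0| := by
  by_contra! hlt
  let A : ℕ → SL(2, ℝ) := fun n => Nat.rec g (fun _ B => B * T * B⁻¹) n
  have hA : ∀ n, A n ∈ Γ := by
    intro n
    induction n with
    | zero => exact hg
    | succ n ih => exact Γ.mul_mem (Γ.mul_mem ih hT) (Γ.inv_mem ih)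
  have conj (B : SL(2, ℝ)) : (B * T * B⁻¹) 0 0 = 1 - B 0 0 * B 1 0 ∧
      (B * T * B⁻¹) 1 0 = - B 1 0 ^ 2 ∧
      frobeniusSq (T⁻¹ * (B * T * B⁻¹)) = (1 - B 0 0 * B 1 0 + B 1 0 ^ 2) ^ 2 +
        (B 0 0 ^ 2 - 1 - B 0 0 * B 1 0) ^ 2 + (B 1 0 ^ 2) ^ 2 + (1 + B 0 0 * B 1 0) ^ 2 := by
    have := det_entries B
    have h00 : (B * T * B⁻¹) 0 0 = 1 - B 0 0 * B 1 0 := by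
      simp only [T_eq_translation, SL2_mul_apply, SL2_inv_apply, translation_apply]
      linear_combination this
    have h10 : (B * T * B⁻¹) 1 0 = - B 1 0 ^ 2 := by
      simp only [T_eq_translation, SL2_mul_apply, SL2_inv_apply, translation_apply]
      ring
    have h01 : (B * T * B⁻¹) 0 1 = B 0 0 ^ 2 := by
      simp only [T_eq_translation, SL2_mul_apply, SL2_inv_apply, translation_apply]
      ring
    have h11 : (B * T * B⁻¹) 1 1 = 1 + B 0 0 * B 1 0 := by
      simp only [T_eq_translation, SL2_mul_apply, SL2_inv_apply, translation_apply]
      linear_combination this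
    refine ⟨h00, h10, ?_⟩
    generalize B * T * B⁻¹ = C at *
    simp only [frobeniusSq, T_eq_translation, SL2_mul_apply, SL2_inv_apply, translation_apply,
      h00, h10, h01, h11]
    ring
  set r := |g 1 0| with hr
  have hr0 : 0 ≤ r := abs_nonneg _
  have hne : ∀ n, A n 1 0 ≠ 0 := by
    intro n
    induction n with
    | zero => exact hc
    | succ n ih => rw [show A (n + 1) 1 0 = _ from (conj (A n)).2.1]; simpa using ih
  have hcr : ∀ n, |A n 1 0| ≤ r ^ (n + 1) := by
    intro n
    induction n with
    | zero => simp [A, hr]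
    | succ n ih =>
      rw [show A (n + 1) 1 0 = _ from (conj (A n)).2.1, abs_neg, abs_pow, sq, pow_succ]
      have : r ^ (n + 1) ≤ r := pow_le_of_le_one hr0 hlt.le (by simp)
      exact mul_le_mul ih (ih.trans this) (abs_nonneg _) (by positivity)
  have hc0 : Filter.Tendsto (fun n => A n 1 0) Filter.atTop (nhds 0) :=
    squeeze_zero_norm hcr
      ((tendsto_pow_atTop_nhds_zero_of_lt_one hr0 hlt).comp (Filter.tendsto_add_atTop_nat 1))
  have ha : ∀ n, |A n 0 0| ≤ max |g 0 0| (1 / (1 - r)) := by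
    intro n
    induction n with
    | zero => exact le_max_left _ _
    | succ n ih =>
      rw [show A (n + 1) 0 0 = _ from (conj (A n)).1]
      set M := max |g 0 0| (1 / (1 - r))
      have hM : 1 / (1 - r) ≤ M := le_max_right _ _
      rw [div_le_iff₀ (by linarith)] at hM
      have h1 : |A n 1 0| ≤ r := (hcr n).trans (pow_le_of_le_one hr0 hlt.le (by simp))
      have h2 : |A n 0 0 * A n 1 0| ≤ M * r := by
        rw [abs_mul]; exact mul_le_mul ih h1 (abs_nonneg _) ((abs_nonneg _).trans ih)
      have h3 := abs_sub (1 : ℝ) (A n 0 0 * A n 1 0)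
      rw [abs_one] at h3
      linarith
  have hac : Filter.Tendsto (fun n => A n 0 0 * A n 1 0) Filter.atTop (nhds 0) := by
    have := (hc0.norm).const_mul (max |g 0 0| (1 / (1 - r)))
    rw [norm_zero, mul_zero] at this
    refine squeeze_zero_norm (fun n => ?_) this
    rw [norm_mul]
    exact mul_le_mul_of_nonneg_right (ha n) (norm_nonneg _)
  have ha1 : Filter.Tendsto (fun n => A n 0 0) Filter.atTop (nhds 1) := by
    rw [← Filter.tendsto_add_atTop_iff_nat 1]
    have : Filter.Tendsto (fun n => 1 - A n 0 0 * A n 1 0) Filter.atTop (nhds 1) := by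
      simpa using hac.const_sub 1
    exact this.congr fun n => (conj (A n)).1.symm
  have hF : Filter.Tendsto (fun n => frobeniusSq (T⁻¹ * A (n + 1))) Filter.atTop (nhds 2) := by
    have h : Filter.Tendsto (fun n => (1 - A n 0 0 * A n 1 0 + A n 1 0 ^ 2) ^ 2 +
        (A n 0 0 ^ 2 - 1 - A n 0 0 * A n 1 0) ^ 2 + (A n 1 0 ^ 2) ^ 2 +
        (1 + A n 0 0 * A n 1 0) ^ 2) Filter.atTop
        (nhds ((1 - 0 + 0 ^ 2) ^ 2 + (1 ^ 2 - 1 - 0) ^ 2 + (0 ^ 2) ^ 2 + (1 + 0) ^ 2)) :=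
      (((((hac.const_sub 1).add (hc0.pow 2)).pow 2).add
        ((((ha1.pow 2).sub_const 1).sub hac).pow 2)).add ((hc0.pow 2).pow 2)).add
        ((hac.const_add 1).pow 2)
    norm_num at h
    exact h.congr fun n => (conj (A n)).2.2.symm
  obtain ⟨n, h1, h2, h3⟩ := ((hF.eventually_lt_const hK).and
    ((hc0.eventually_lt_const (show (0 : ℝ) < 1 by norm_num)).and
      (ha1.eventually_const_lt (show (1 / 2 : ℝ) < 1 by norm_num)))).exists
  have hmem : T⁻¹ * A (n + 1) ∈ Γ := Γ.mul_mem (Γ.inv_mem hT) (hA (n + 1))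
  have heq : frobeniusSq (T⁻¹ * A (n + 1)) = 2 := (hΓ _ hmem).resolve_right h1.not_gt
  rw [show frobeniusSq (T⁻¹ * A (n + 1)) = _ from (conj (A n)).2.2] at heq
  have hz : A n 1 0 * (A n 1 0 - 2 * A n 0 0) = 0 := by
    nlinarith [sq_nonneg (A n 1 0 * (A n 1 0 - 2 * A n 0 0)),
      sq_nonneg (A n 0 0 ^ 2 - 1 - A n 0 0 * A n 1 0 - A n 1 0 ^ 2)]
  rcases mul_eq_zero.mp hz with h | h
  · exact hne n h
  · linarith

lemma sq_diag_eq_one_of_lower_left_eq_zero {Γ : Subgroup SL(2, ℝ)} {K : ℝ} (hK : 2 < K)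
    (hT : T ∈ Γ) (hΓ : ∀ g ∈ Γ, frobeniusSq g = 2 ∨ K < frobeniusSq g) {g : SL(2, ℝ)}
    (hg : g ∈ Γ) (hc : g 1 0 = 0) : g 1 1 ^ 2 = 1 := by
  have not_lt : ∀ g ∈ Γ, g 1 0 = 0 → ¬ |g 0 0| < 1 := by
    intro g hg hc hlt
    have hdet := det_entries g
    rw [hc, mul_zero, sub_zero] at hdet
    have hmem : ∀ n : ℕ, translation ((g 0 0 ^ 2) ^ n) ∈ Γ := by
      intro n
      induction n with
      | zero => simpa [T_eq_translation] using hT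
      | succ n ih =>
        convert Γ.mul_mem (Γ.mul_mem hg ih) (Γ.inv_mem hg) using 1
        symm
        apply eq_translation <;>
          simp only [SL2_mul_apply, SL2_inv_apply, translation_apply, hc]
        · linear_combination hdet
        · ring
        · ring
        · linear_combination hdet
    have hlim : Filter.Tendsto (fun n : ℕ => frobeniusSq (translation ((g 0 0 ^ 2) ^ n)))
        Filter.atTop (nhds 2) := by
      have h := ((tendsto_pow_atTop_nhds_zero_of_lt_one (sq_nonneg (g 0 0))
        ((sq_lt_one_iff_abs_lt_one _).mpr hlt)).pow 2).const_add 2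
      norm_num at h
      refine h.congr fun n => ?_
      simp [frobeniusSq, translation]
      ring
    obtain ⟨n, hn⟩ := (hlim.eventually_lt_const hK).exists
    have heq := (hΓ _ (hmem n)).resolve_right hn.not_gt
    have h0 : g 0 0 ≠ 0 := by rintro h; simp [h] at hdet
    have : 0 < ((g 0 0 ^ 2) ^ n) ^ 2 := by positivity
    simp [frobeniusSq, translation] at heq
    nlinarith
  have hdet := det_entries g
  rw [hc, mul_zero, sub_zero] at hdet
  have h1 := not_lt g hg hc
  have h2 := not_lt g⁻¹ (Γ.inv_mem hg)
    (by rw [(SL2_inv_apply g).2.2.1, hc, neg_zero])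
  rw [(SL2_inv_apply g).1] at h2
  push Not at h1 h2
  have h3 : |g 0 0| * |g 1 1| = 1 := by rw [← abs_mul, hdet, abs_one]
  rw [← sq_abs]
  nlinarith

lemma card_mul_le_of_cyclically_separated {α : Type*} (F : Finset α) (f : α → ℝ) {h L : ℝ}
    (hh : 0 < h) (hL : h ≤ L)
    (hf : ∀ a ∈ F, ∀ b ∈ F, a ≠ b → h ≤ |f a - f b| ∧ |f a - f b| ≤ L - h) :
    F.card * h ≤ L := by
  rcases F.eq_empty_or_nonempty with rfl | hF
  · simpa using hh.le.trans hL
  obtain ⟨m, hm, hmin⟩ := F.exists_min_image f hF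
  have hrange : ∀ a ∈ F, f a - f m ≤ L - h := by
    intro a ha
    by_cases ham : a = m
    · simpa [ham] using hL
    · exact (le_abs_self _).trans (hf a ha m hm ham).2
  have hcard : F.card ≤ (Finset.range (⌊(L - h) / h⌋₊ + 1)).card := by
    refine Finset.card_le_card_of_injOn (fun a => ⌊(f a - f m) / h⌋₊) ?_ ?_
    · intro a ha
      simp only [Finset.coe_range, Set.mem_Iio, Nat.lt_succ_iff]
      exact Nat.floor_le_floor (div_le_div_of_nonneg_right (hrange a ha) hh.le)
    · intro a ha b hb hab
      by_contra hne
      have hsep := (hf a ha b hb hne).1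
      have h0 : ∀ c ∈ F, 0 ≤ (f c - f m) / h :=
        fun c hc => div_nonneg (sub_nonneg.mpr (hmin c hc)) hh.le
      have ha1 := Nat.floor_le (h0 a ha)
      have ha2 := Nat.lt_floor_add_one ((f a - f m) / h)
      have hb1 := Nat.floor_le (h0 b hb)
      have hb2 := Nat.lt_floor_add_one ((f b - f m) / h)
      simp only at hab
      rw [hab] at ha1 ha2
      have : |(f a - f m) / h - (f b - f m) / h| < 1 := by rw [abs_lt]; constructor <;> linarith
      rw [← sub_div, abs_div, abs_of_pos hh, div_lt_one hh, sub_sub_sub_cancel_right] at this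
      linarith
  rw [Finset.card_range] at hcard
  have h1 : (F.card : ℝ) ≤ (L - h) / h + 1 := by
    calc (F.card : ℝ) ≤ ⌊(L - h) / h⌋₊ + 1 := by exact_mod_cast hcard
      _ ≤ _ := by
        gcongr
        exact Nat.floor_le (div_nonneg (by linarith) hh.le)
  calc F.card * h ≤ ((L - h) / h + 1) * h := by gcongr
    _ = L := by field_simp; ring

lemma translation_smul_re (x : ℝ) (z : ℍ) : (translation x • z).re = z.re + x := by
  rw [← UpperHalfPlane.coe_re, UpperHalfPlane.specialLinearGroup_apply]
  simp [translation_apply]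

/-- The automorphy factor `c z + d`. -/
def automorphyFactor (g : SL(2, ℝ)) (z : ℍ) : ℂ := g 1 0 * z + g 1 1

lemma automorphyFactor_re (g : SL(2, ℝ)) (z : ℍ) :
    (automorphyFactor g z).re = g 1 0 * z.re + g 1 1 := by
  simp [automorphyFactor]

lemma automorphyFactor_im (g : SL(2, ℝ)) (z : ℍ) :
    (automorphyFactor g z).im = g 1 0 * z.im := by
  simp [automorphyFactor]

lemma automorphyFactor_ne_zero (g : SL(2, ℝ)) (z : ℍ) : automorphyFactor g z ≠ 0 := by
  intro h
  have him := automorphyFactor_im g z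
  have hre := automorphyFactor_re g z
  have hdet := det_entries g
  rw [h, Complex.zero_im, eq_comm, mul_eq_zero, or_iff_left z.im_ne_zero] at him
  rw [h, him, Complex.zero_re, zero_mul, zero_add] at hre
  simp [him, ← hre] at hdet

lemma im_smul_eq (g : SL(2, ℝ)) (z : ℍ) :
    (g • z).im = z.im / ‖automorphyFactor g z‖ ^ 2 := by
  have hne := automorphyFactor_ne_zero g z
  have hdet := det_entries g
  rw [← UpperHalfPlane.coe_im, UpperHalfPlane.specialLinearGroup_apply]
  change ((g 0 0 * z + g 0 1) / automorphyFactor g z : ℂ).im = _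
  rw [Complex.div_im, ← Complex.normSq_eq_norm_sq, automorphyFactor_re, automorphyFactor_im,
    ← sub_div]
  congr 1
  simp
  linear_combination z.im * hdet

lemma norm_mul_norm_mul_sin_arg_sub (v w : ℂ) :
    ‖v‖ * ‖w‖ * Real.sin (w.arg - v.arg) = v.re * w.im - v.im * w.re := by
  rw [Real.sin_sub, ← Complex.norm_mul_cos_arg v, ← Complex.norm_mul_cos_arg w,
    ← Complex.norm_mul_sin_arg v, ← Complex.norm_mul_sin_arg w]
  ring

lemma norm_automorphyFactor_mul_sin_arg_sub (g h : SL(2, ℝ)) (z : ℍ) :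
    ‖automorphyFactor g z‖ * ‖automorphyFactor h z‖ *
      Real.sin ((automorphyFactor h z).arg - (automorphyFactor g z).arg) =
      z.im * (h * g⁻¹) 1 0 := by
  rw [norm_mul_norm_mul_sin_arg_sub, automorphyFactor_re, automorphyFactor_re,
    automorphyFactor_im, automorphyFactor_im, SL2_mul_apply]
  simp only [SL2_inv_apply]
  ring

lemma le_abs_and_abs_le_of_le_abs_sin {s x : ℝ} (hs : s ≤ |Real.sin x|) (hx : |x| ≤ 2 * Real.pi) :
    s ≤ |x| ∧ |x| ≤ 2 * Real.pi - s := by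
  refine ⟨hs.trans Real.abs_sin_le_abs, ?_⟩
  have h1 : |Real.sin x| = |Real.sin (2 * Real.pi - |x|)| := by
    rw [Real.sin_two_pi_sub, abs_neg]
    rcases abs_choice x with h | h <;> simp [h]
  have h2 := Real.abs_sin_le_abs (x := 2 * Real.pi - |x|)
  rw [abs_of_nonneg (sub_nonneg.mpr hx)] at h2
  linarith

lemma abs_arg_sub_separated {Γ : Subgroup SL(2, ℝ)} {K : ℝ} (hK : 2 < K) (hT : T ∈ Γ)
    (hΓ : ∀ g ∈ Γ, frobeniusSq g = 2 ∨ K < frobeniusSq g) {g h : SL(2, ℝ)} (hg : g ∈ Γ)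
    (hh : h ∈ Γ) {z : ℍ} {t : ℝ} (ht : 0 ≤ t)
    (hgz : ‖automorphyFactor g z‖ ^ 2 ≤ Real.exp t * z.im)
    (hhz : ‖automorphyFactor h z‖ ^ 2 ≤ Real.exp t * z.im)
    (hne : (automorphyFactor h z).arg ≠ (automorphyFactor g z).arg) :
    Real.exp (-t) ≤ |(automorphyFactor h z).arg - (automorphyFactor g z).arg| ∧
      |(automorphyFactor h z).arg - (automorphyFactor g z).arg| ≤ 2 * Real.pi - Real.exp (-t) := by
  have hsin := norm_automorphyFactor_mul_sin_arg_sub g h z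
  have hpos := mul_pos (norm_pos_iff.mpr (automorphyFactor_ne_zero g z))
    (norm_pos_iff.mpr (automorphyFactor_ne_zero h z))
  have h1 := Complex.neg_pi_lt_arg (automorphyFactor g z)
  have h2 := Complex.arg_le_pi (automorphyFactor g z)
  have h3 := Complex.neg_pi_lt_arg (automorphyFactor h z)
  have h4 := Complex.arg_le_pi (automorphyFactor h z)
  set x := (automorphyFactor h z).arg - (automorphyFactor g z).arg with hx
  have hx2 : |x| < 2 * Real.pi := by rw [abs_lt]; constructor <;> linarith
  by_cases hc : (h * g⁻¹) 1 0 = 0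
  · rw [hc, mul_zero, mul_eq_zero, or_iff_right hpos.ne', Real.sin_eq_zero_iff] at hsin
    obtain ⟨n, hn⟩ := hsin
    have hn0 : n ≠ 0 := by
      rintro rfl
      simp only [Int.cast_zero, zero_mul] at hn
      exact hne (by linarith)
    have hn1 : (1 : ℝ) ≤ |(n : ℝ)| := by exact_mod_cast Int.one_le_abs hn0
    have hn2 : |(n : ℝ)| < 2 := by
      rw [← hn, abs_mul, abs_of_pos Real.pi_pos] at hx2
      exact lt_of_mul_lt_mul_right hx2 Real.pi_pos.le
    have hn3 : |n| = 1 := by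
      have h5 : |n| < 2 := by exact_mod_cast hn2
      have h6 := Int.one_le_abs hn0
      omega
    have hn4 : |(n : ℝ)| = 1 := by exact_mod_cast hn3
    rw [← hn, abs_mul, abs_of_pos Real.pi_pos, hn4]
    have := Real.exp_le_one_iff.mpr (neg_nonpos.mpr ht)
    have := Real.pi_gt_three
    constructor <;> linarith
  · refine le_abs_and_abs_le_of_le_abs_sin ?_ hx2.le
    have hc1 := one_le_abs_lower_left hK hT hΓ (Γ.mul_mem hh (Γ.inv_mem hg)) hc
    have habs := congrArg abs hsin
    rw [abs_mul, abs_of_pos hpos, abs_mul, abs_of_pos z.im_pos] at habs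
    have hle : ‖automorphyFactor g z‖ * ‖automorphyFactor h z‖ ≤ Real.exp t * z.im := by
      nlinarith [sq_nonneg (‖automorphyFactor g z‖ - ‖automorphyFactor h z‖)]
    have hzs : z.im * 1 ≤ Real.exp t * z.im * |Real.sin x| :=
      calc z.im * 1 ≤ z.im * |(h * g⁻¹) 1 0| := mul_le_mul_of_nonneg_left hc1 z.im_pos.le
        _ = _ := habs.symm
        _ ≤ _ := mul_le_mul_of_nonneg_right hle (abs_nonneg _)
    have h5 : 1 ≤ Real.exp t * |Real.sin x| := by
      refine le_of_mul_le_mul_left ?_ z.im_pos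
      linarith
    rw [Real.exp_neg, inv_le_iff_one_le_mul₀' (Real.exp_pos t)]
    exact h5

lemma exists_eq_translation_mul {Γ : Subgroup SL(2, ℝ)} {K : ℝ} (hK : 2 < K) (hT : T ∈ Γ)
    (hΓ : ∀ g ∈ Γ, frobeniusSq g = 2 ∨ K < frobeniusSq g) {g h : SL(2, ℝ)} (hg : g ∈ Γ)
    (hh : h ∈ Γ) {z : ℍ} (heq : (automorphyFactor h z).arg = (automorphyFactor g z).arg) :
    ∃ x, h = translation x * g := by
  have hsin := norm_automorphyFactor_mul_sin_arg_sub g h z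
  rw [heq, sub_self, Real.sin_zero, mul_zero, eq_comm, mul_eq_zero,
    or_iff_right z.im_ne_zero] at hsin
  have hd := sq_diag_eq_one_of_lower_left_eq_zero hK hT hΓ (Γ.mul_mem hh (Γ.inv_mem hg)) hsin
  obtain ⟨k, rfl⟩ : ∃ k, h = k * g := ⟨h * g⁻¹, by group⟩
  rw [mul_inv_cancel_right] at hsin hd
  have hdet := det_entries k
  rw [hsin, mul_zero, sub_zero] at hdet
  have hfac : automorphyFactor (k * g) z = k 1 1 * automorphyFactor g z := by
    simp only [automorphyFactor, SL2_mul_apply, hsin]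
    push_cast
    ring
  have hk : k 1 1 = 1 := by
    rw [sq, mul_self_eq_one_iff] at hd
    refine hd.resolve_right fun hneg => automorphyFactor_ne_zero g z ?_
    have hfac' : automorphyFactor (k * g) z = -automorphyFactor g z := by simp [hfac, hneg]
    refine self_eq_neg.mp ((hfac' ▸ Complex.ext_norm_arg ?_ heq : _ = _).symm)
    rw [hfac', norm_neg]
  exact ⟨k 0 1, by rw [← eq_translation (by simpa [hk] using hdet) rfl hsin hk]⟩

lemma le_abs_of_translation_mem {Γ : Subgroup SL(2, ℝ)} {ε : ℝ} (hε : 0 < ε)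
    (hΓ : ∀ g ∈ Γ, frobeniusSq g = 2 ∨ 2 * Real.cosh (2 * ε) < frobeniusSq g) {x : ℝ}
    (hx : translation x ∈ Γ) (hx0 : x ≠ 0) : 2 * ε ≤ |x| := by
  have hF : frobeniusSq (translation x) = 2 + x ^ 2 := by
    simp only [frobeniusSq, translation_apply]
    ring
  have h := hΓ _ hx
  rw [hF] at h
  have h1 : 2 * Real.cosh (2 * ε) < 2 + x ^ 2 := h.resolve_left (by simpa using hx0)
  rw [Real.cosh_two_mul, Real.cosh_sq] at h1
  have h2 : ε ≤ Real.sinh ε := Real.self_le_sinh_iff.mpr hε.le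
  rw [← abs_of_pos (show 0 < 2 * ε by positivity), ← sq_le_sq]
  nlinarith

lemma card_le_of_norm_automorphyFactor_le {Γ : Subgroup SL(2, ℝ)} {ε : ℝ} (hε : 0 < ε)
    (hT : T ∈ Γ) (hΓ : ∀ g ∈ Γ, frobeniusSq g = 2 ∨ 2 * Real.cosh (2 * ε) < frobeniusSq g)
    {ι : Type*} (F : Finset ι) (δ : ι → SL(2, ℝ)) (hδ : ∀ a ∈ F, δ a ∈ Γ)
    (hinj : ∀ a ∈ F, ∀ b ∈ F, ∀ m : ℤ, δ b = T ^ m * δ a → a = b) {z : ℍ} {t : ℝ} (ht : 0 ≤ t)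
    (hz : ∀ a ∈ F, ‖automorphyFactor (δ a) z‖ ^ 2 ≤ Real.exp t * z.im) :
    F.card ≤ Real.pi / ε * Real.exp t := by
  have hK : 2 < 2 * Real.cosh (2 * ε) := by
    have := Real.one_lt_cosh.mpr (show 2 * ε ≠ 0 by positivity)
    linarith
  have hε1 : 2 * ε ≤ 1 := by
    simpa using le_abs_of_translation_mem hε hΓ (T_eq_translation ▸ hT) one_ne_zero
  let θ : ι → ℝ := fun a => (automorphyFactor (δ a) z).arg
  have himage : (F.image θ).card * Real.exp (-t) ≤ 2 * Real.pi := by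
    have := Real.exp_le_one_iff.mpr (neg_nonpos.mpr ht)
    have := Real.pi_gt_three
    refine card_mul_le_of_cyclically_separated _ id (Real.exp_pos _) (by linarith) ?_
    intro x hx y hy hxy
    obtain ⟨a, ha, rfl⟩ := Finset.mem_image.mp hx
    obtain ⟨b, hb, rfl⟩ := Finset.mem_image.mp hy
    exact abs_arg_sub_separated hK hT hΓ (hδ b hb) (hδ a ha) ht (hz b hb) (hz a ha) hxy
  have hfiber : ∀ y, ((F.filter fun a => θ a = y).card : ℝ) * (2 * ε) ≤ 1 := by
    intro y
    refine card_mul_le_of_cyclically_separated _ (fun a => Int.fract (δ a • z).re)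
      (by positivity) hε1 ?_
    intro b hb a ha hab
    obtain ⟨hb, hby⟩ := Finset.mem_filter.mp hb
    obtain ⟨ha, hay⟩ := Finset.mem_filter.mp ha
    obtain ⟨x, hx⟩ := exists_eq_translation_mul hK hT hΓ (hδ a ha) (hδ b hb) (hby.trans hay.symm)
    have hxmem : translation x ∈ Γ := by
      rw [eq_mul_inv_of_mul_eq hx.symm]
      exact Γ.mul_mem (hδ b hb) (Γ.inv_mem (hδ a ha))
    have hshift : ∀ m : ℤ, x + m ≠ 0 → 2 * ε ≤ |x + m| := fun m =>
      le_abs_of_translation_mem hε hΓ (by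
        rw [← translation_mul, ← T_zpow]
        exact Γ.mul_mem hxmem (Γ.zpow_mem hT m))
    set m : ℤ := ⌊(δ a • z).re⌋ - ⌊(δ b • z).re⌋ with hm
    have hD : Int.fract (δ b • z).re - Int.fract (δ a • z).re = x + m := by
      rw [Int.fract, Int.fract, hm, hx, mul_smul, translation_smul_re]
      push_cast
      ring
    have h1 := Int.fract_nonneg (δ b • z).re
    have h2 := Int.fract_lt_one (δ b • z).re
    have h3 := Int.fract_nonneg (δ a • z).re
    have h4 := Int.fract_lt_one (δ a • z).re
    simp only [hD]
    have hlt : |x + m| < 1 := by rw [← hD, abs_lt]; constructor <;> linarith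
    have hne : x + m ≠ 0 := by
      intro h0
      refine hab (hinj a ha b hb (-m) ?_).symm
      rw [hx, T_zpow]
      congr 2
      push_cast
      linarith
    refine ⟨hshift m hne, ?_⟩
    rw [abs_lt] at hlt
    have hp := hshift (m + 1) (by push_cast; linarith)
    have hn := hshift (m - 1) (by push_cast; linarith)
    push_cast at hp hn
    rw [abs_of_pos (by linarith)] at hp
    rw [abs_of_neg (by linarith)] at hn
    rw [abs_le]
    constructor <;> linarith
  have hcard : F.card ≤ ⌊1 / (2 * ε)⌋₊ * (F.image θ).card :=
    Finset.card_le_mul_card_image _ _ fun y _ =>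
      Nat.le_floor ((le_div_iff₀ (by positivity)).mpr (hfiber y))
  have himage2 : ((F.image θ).card : ℝ) ≤ 2 * Real.pi * Real.exp t := by
    rwa [Real.exp_neg, ← div_eq_mul_inv, div_le_iff₀ (Real.exp_pos t)] at himage
  calc (F.card : ℝ) ≤ ⌊1 / (2 * ε)⌋₊ * (F.image θ).card := by exact_mod_cast hcard
    _ ≤ 1 / (2 * ε) * (2 * Real.pi * Real.exp t) := by
      gcongr
      exact Nat.floor_le (by positivity)
    _ = Real.pi / ε * Real.exp t := by field_simp

lemma pi_div_le_exp_div_sinh_sq {ε : ℝ} (hε : 0 < ε) (hε1 : 2 * ε ≤ 1) :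
    Real.pi / ε ≤ Real.exp ε / (2 * Real.sinh (ε / 2) ^ 2) := by
  have hs : 0 < Real.sinh (ε / 2) := Real.sinh_pos_iff.mpr (by positivity)
  have h1 : 2 * Real.sinh (ε / 2) ≤ Real.exp (ε / 2) * ε := by
    have h2 := Real.add_one_le_exp (-ε)
    have h3 : Real.exp (-(ε / 2)) = Real.exp (ε / 2) * Real.exp (-ε) := by
      rw [← Real.exp_add]
      ring_nf
    rw [Real.sinh_eq, h3]
    nlinarith [Real.exp_pos (ε / 2)]
  have h4 : (2 * Real.sinh (ε / 2)) ^ 2 ≤ Real.exp ε * ε ^ 2 :=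
    calc (2 * Real.sinh (ε / 2)) ^ 2 ≤ (Real.exp (ε / 2) * ε) ^ 2 := by gcongr
      _ = Real.exp ε * ε ^ 2 := by
        rw [mul_pow, ← Real.exp_nat_mul]
        congr 2
        push_cast
        ring
  rw [div_le_div_iff₀ hε (by positivity)]
  have h5 : Real.pi * ε ≤ 2 := by nlinarith [Real.pi_lt_four]
  have h6 : Real.exp ε * ε * (Real.pi * ε) ≤ Real.exp ε * ε * 2 := by gcongr
  nlinarith [Real.pi_pos, mul_le_mul_of_nonneg_left h4 Real.pi_pos.le]

/-- Proposition 2.1 (conditional form): if the hyperbolic `ε`-balls about distinct points of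
the orbit `Γ·i` are pairwise disjoint, then for `z ∈ ℍ` with `im z < 1` and `t ≥ 0` the set
`A(z,t)` is finite with `Π(z,t) ≤ (e^ε / (2 sinh²(ε/2))) e^t`. -/
theorem orbit_counting_bound (ε : ℝ) (hε : 0 < ε)
    (hdisj : ∀ δ₁ δ₂ : Γ,
      (δ₁ : SL(2, ℝ)) • UpperHalfPlane.I ≠ (δ₂ : SL(2, ℝ)) • UpperHalfPlane.I →
      2 * ε < dist ((δ₁ : SL(2, ℝ)) • UpperHalfPlane.I) ((δ₂ : SL(2, ℝ)) • UpperHalfPlane.I)) :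
    ∀ z : ℍ, z.im < 1 → ∀ t : ℝ, 0 ≤ t →
      (Aset Γ hT z t).Finite ∧
      ((Aset Γ hT z t).ncard : ℝ) ≤ Real.exp ε / (2 * Real.sinh (ε / 2) ^ 2) * Real.exp t := by
  intro z _ t ht
  have hΓ : ∀ g ∈ Γ, frobeniusSq g = 2 ∨ 2 * Real.cosh (2 * ε) < frobeniusSq g := by
    intro g hg
    rw [← two_mul_cosh_dist_I]
    by_cases h : UpperHalfPlane.I = g • UpperHalfPlane.I
    · left
      rw [← h, dist_self, Real.cosh_zero, mul_one]
    · right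
      have hd := hdisj 1 ⟨g, hg⟩ (by simpa using h)
      simp only [OneMemClass.coe_one, one_smul] at hd
      have := Real.cosh_lt_cosh.mpr (show
        |2 * ε| < |dist UpperHalfPlane.I (g • UpperHalfPlane.I)| by
          rwa [abs_of_pos (by positivity), abs_of_nonneg dist_nonneg])
      linarith
  have hε1 : 2 * ε ≤ 1 := by
    simpa using le_abs_of_translation_mem hε hΓ (T_eq_translation ▸ hT) one_ne_zero
  choose δ hδ hdist using fun q : Aset Γ hT z t => q.2
  have hcard (F : Finset (Aset Γ hT z t)) :
      (F.card : ℝ) ≤ Real.exp ε / (2 * Real.sinh (ε / 2) ^ 2) * Real.exp t := by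
    refine (card_le_of_norm_automorphyFactor_le hε hT hΓ F (fun q => (δ q : SL(2, ℝ)))
      (fun q _ => (δ q).2) ?_ (z := z) ht ?_).trans
      (mul_le_mul_of_nonneg_right (pi_div_le_exp_div_sinh_sq hε hε1) (Real.exp_pos t).le)
    · intro a _ b _ m hab
      rw [Subtype.ext_iff, ← hδ a, ← hδ b]
      refine Quotient.sound (QuotientGroup.rightRel_apply.mpr
        (Subgroup.mem_zpowers_iff.mpr ⟨m, ?_⟩))
      rw [eq_mul_inv_iff_mul_eq]
      exact Subtype.ext hab.symm
    · intro a _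
      have him := UpperHalfPlane.im_le_im_mul_exp_dist UpperHalfPlane.I ((δ a : SL(2, ℝ)) • z)
      rw [UpperHalfPlane.I_im, im_smul_eq] at him
      have hpos : 0 < ‖automorphyFactor (δ a) z‖ ^ 2 :=
        pow_pos (norm_pos_iff.mpr (automorphyFactor_ne_zero _ z)) 2
      have h2 : 1 ≤ z.im / ‖automorphyFactor (δ a) z‖ ^ 2 * Real.exp t :=
        him.trans (mul_le_mul_of_nonneg_left (Real.exp_le_exp.mpr (hdist a))
          (div_nonneg z.im_pos.le hpos.le))
      rw [div_mul_eq_mul_div, one_le_div hpos] at h2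
      linarith
  have hfin : Finite (Aset Γ hT z t) := by
    by_contra hinf
    rw [not_finite_iff_infinite] at hinf
    obtain ⟨n, hn⟩ := exists_nat_gt
      (Real.exp ε / (2 * Real.sinh (ε / 2) ^ 2) * Real.exp t)
    obtain ⟨F, hF⟩ := Infinite.exists_subset_card_eq (Aset Γ hT z t) n
    exact absurd (hF ▸ hcard F) hn.not_ge
  refine ⟨Set.toFinite _, ?_⟩
  have := Fintype.ofFinite (Aset Γ hT z t)
  rw [← Nat.card_coe_set_eq, Nat.card_eq_fintype_card]
  exact hcard Finset.univ
end
end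

section
/- (Equation (2.3): the Eisenstein series is an eigenfunction of the hyperbolic Laplacian.) Let Γ be a subgroup of SL(2,ℝ) containing T such that Γ is discrete (Γ, as a subgroup of the topological group SL(2,ℝ) of 2×2 real matrices, carries the discrete topology), and let s ∈ ℂ with Re s > 1. Define F : ℝ → ℝ → ℂ for y > 0 by F x y = ∑'_{q ∈ Γ∞\Γ} ((im(δ·(x+iy))) : ℂ)^s (δ any representative of q, x+iy regarded as a point of ℍ). Then for every x ∈ ℝ and y > 0 the defining series is summable and y² · ((∂²F/∂x²)(x,y) + (∂²F/∂y²)(x,y)) = s·(s−1)·F x y, where ∂²F/∂x² denotes the second derivative of t ↦ F t y at t = x and ∂²F/∂y² the second derivative of t ↦ F x t at t = y. -/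
open scoped UpperHalfPlane MatrixGroups
open UpperHalfPlane

noncomputable section

/-- The topology on `SL(2,ℝ)` induced from the space of `2×2` real matrices. -/
instance : TopologicalSpace SL(2, ℝ) :=
  TopologicalSpace.induced (fun g => (g : Matrix (Fin 2) (Fin 2) ℝ)) inferInstance

variable (Γ : Subgroup SL(2, ℝ))

variable (hT : T ∈ Γ)

/-- The complex term `((im (δ·z)) : ℂ)^s` of the Eisenstein series attached to a coset
`q ∈ Γ∞\Γ` (`δ` a representative of `q`; independent of the representative). -/
def cEisTerm (z : ℍ) (s : ℂ) (q : Cosets Γ hT) : ℂ :=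
  ((((Quotient.out q : Γ) : SL(2, ℝ)) • z).im : ℂ) ^ s

open Set Filter Topology

theorem deriv_deriv_tsum_of_bound {ι : Type*} {f f' f'' : ι → ℝ → ℂ} {u : ι → ℝ} {U : Set ℝ}
    {x : ℝ} (hU : IsOpen U) (hU' : IsPreconnected U) (hx : x ∈ U) (hu : Summable u)
    (hf : ∀ i, ∀ t ∈ U, HasDerivAt (f i) (f' i t) t)
    (hf' : ∀ i, ∀ t ∈ U, HasDerivAt (f' i) (f'' i t) t)
    (hb : ∀ i, ∀ t ∈ U, ‖f' i t‖ ≤ u i) (hb' : ∀ i, ∀ t ∈ U, ‖f'' i t‖ ≤ u i)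
    (hs : Summable fun i ↦ f i x) :
    deriv (deriv fun t ↦ ∑' i, f i t) x = ∑' i, f'' i x := by
  have h1 : ∀ t ∈ U, deriv (fun t ↦ ∑' i, f i t) t = ∑' i, f' i t := fun t ht ↦
    (hasDerivAt_tsum_of_isPreconnected hu hU hU' hf hb hx hs ht).deriv
  have h2 : deriv (fun t ↦ ∑' i, f i t) =ᶠ[𝓝 x] fun t ↦ ∑' i, f' i t :=
    Filter.eventuallyEq_of_mem (hU.mem_nhds hx) h1
  rw [h2.deriv_eq]
  exact (hasDerivAt_tsum_of_isPreconnected hu hU hU' hf' hb' hx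
    (Summable.of_norm_bounded hu fun i ↦ hb i x hx) hx).deriv

theorem deriv_deriv_tsum_cexp {ι : Type*} {g g' g'' : ι → ℝ → ℝ} {v : ι → ℝ} {U : Set ℝ}
    {x B : ℝ} {s : ℂ} (hU : IsOpen U) (hU' : IsPreconnected U) (hx : x ∈ U)
    (hv : Summable v)
    (hg : ∀ i, ∀ t ∈ U, HasDerivAt (g i) (g' i t) t)
    (hg' : ∀ i, ∀ t ∈ U, HasDerivAt (g' i) (g'' i t) t)
    (hb : ∀ i, ∀ t ∈ U, |g' i t| ≤ B) (hb' : ∀ i, ∀ t ∈ U, |g'' i t| ≤ B)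
    (hbv : ∀ i, ∀ t ∈ U, Real.exp (s.re * g i t) ≤ v i) :
    Summable (fun i ↦ (s * g'' i x + s ^ 2 * (g' i x : ℂ) ^ 2) * Complex.exp (s * g i x)) ∧
    deriv (deriv fun t ↦ ∑' i, Complex.exp (s * g i t)) x =
      ∑' i, (s * g'' i x + s ^ 2 * (g' i x : ℂ) ^ 2) * Complex.exp (s * g i x) := by
  have hn : ∀ i, ∀ t ∈ U, ‖Complex.exp (s * g i t)‖ ≤ v i := fun i t ht ↦ by
    rw [Complex.norm_exp]; simpa using hbv i t ht
  have hB : ∀ i : ι, 0 ≤ B := fun i ↦ (abs_nonneg _).trans (hb i x hx)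
  have hv0 : ∀ i, 0 ≤ v i := fun i ↦ (Real.exp_pos _).le.trans (hbv i x hx)
  set K : ℝ := ‖s‖ * B + ‖s‖ ^ 2 * B ^ 2 with hK
  have hb1 : ∀ i, ∀ t ∈ U, ‖s * g' i t * Complex.exp (s * g i t)‖ ≤ K * v i := fun i t ht ↦ by
    rw [norm_mul, norm_mul, Complex.norm_real, Real.norm_eq_abs]
    have := hB i
    have := hb i t ht
    have := hn i t ht
    have h3 : ‖s‖ * |g' i t| ≤ K := by
      have : ‖s‖ * |g' i t| ≤ ‖s‖ * B := by gcongr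
      have : 0 ≤ ‖s‖ ^ 2 * B ^ 2 := by positivity
      linarith
    gcongr
  have hb2 : ∀ i, ∀ t ∈ U,
      ‖(s * g'' i t + s ^ 2 * (g' i t : ℂ) ^ 2) * Complex.exp (s * g i t)‖ ≤ K * v i :=
    fun i t ht ↦ by
      rw [norm_mul]
      have h0 := hB i
      have h1 := hb i t ht
      have h2 := hb' i t ht
      have h3 := hn i t ht
      have h4 : ‖s * g'' i t + s ^ 2 * (g' i t : ℂ) ^ 2‖ ≤ K := by
        refine (norm_add_le _ _).trans ?_
        rw [norm_mul, norm_mul, norm_pow, norm_pow, Complex.norm_real, Complex.norm_real,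
          Real.norm_eq_abs, Real.norm_eq_abs, hK]
        gcongr
      gcongr
  refine ⟨Summable.of_norm_bounded (hv.mul_left K) fun i ↦ hb2 i x hx,
    deriv_deriv_tsum_of_bound (f' := fun i t ↦ s * g' i t * Complex.exp (s * g i t))
      (f'' := fun i t ↦ (s * g'' i t + s ^ 2 * (g' i t : ℂ) ^ 2) * Complex.exp (s * g i t))
      hU hU' hx (hv.mul_left K) ?_ ?_ hb1 hb2
      (Summable.of_norm_bounded hv fun i ↦ hn i x hx)⟩
  · intro i t ht
    have := ((hg i t ht).ofReal_comp.const_mul s).cexp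
    convert! this using 1
    ring
  · intro i t ht
    have h1 := ((hg i t ht).ofReal_comp.const_mul s).cexp
    have h2 := ((hg' i t ht).ofReal_comp.const_mul s)
    convert! h2.mul h1 using 1
    ring

theorem ofReal_div_cpow_eq_cexp {y q : ℝ} (hy : 0 < y) (hq : 0 < q) (s : ℂ) :
    ((y / q : ℝ) : ℂ) ^ s = Complex.exp (s * ((Real.log y - Real.log q : ℝ) : ℂ)) := by
  rw [Complex.cpow_def_of_ne_zero (by exact_mod_cast (div_pos hy hq).ne'),
    ← Complex.ofReal_log (div_pos hy hq).le, Real.log_div hy.ne' hq.ne', mul_comm]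

theorem exp_mul_log_sub_le {y q y' q' k σ : ℝ} (hy : 0 < y) (hq : 0 < q) (hy' : 0 < y')
    (hq' : 0 < q') (hk : 0 < k) (hσ : 0 ≤ σ) (h : y / q ≤ k * (y' / q')) :
    Real.exp (σ * (Real.log y - Real.log q)) ≤ k ^ σ * (y' / q') ^ σ := by
  rw [← Real.log_div hy.ne' hq.ne', mul_comm, ← Real.rpow_def_of_pos (div_pos hy hq),
    ← Real.mul_rpow hk.le (div_pos hy' hq').le]
  exact Real.rpow_le_rpow (div_pos hy hq).le h hσ

section PoincareSeries

variable {ι : Type*} {c d : ι → ℝ} {s : ℂ} {x y : ℝ}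

theorem sq_add_sq_pos_of_ne_zero {c d : ℝ} (h : c ≠ 0 ∨ d ≠ 0) (t : ℝ) {y : ℝ} (hy : 0 < y) :
    0 < (c * t + d) ^ 2 + (c * y) ^ 2 := by
  by_cases hc : c = 0
  · subst hc
    have : d ≠ 0 := by simpa using h
    simp; positivity
  · positivity

theorem deriv_deriv_re_tsum_im (hcd : ∀ i, c i ≠ 0 ∨ d i ≠ 0) (hy : 0 < y) (hs : 0 ≤ s.re)
    (hsum : Summable fun i ↦ (y / ((c i * x + d i) ^ 2 + (c i * y) ^ 2)) ^ s.re) :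
    Summable (fun i ↦ (s * (-(2 * c i ^ 2) / ((c i * x + d i) ^ 2 + (c i * y) ^ 2) +
        (2 * c i * (c i * x + d i)) ^ 2 / ((c i * x + d i) ^ 2 + (c i * y) ^ 2) ^ 2 : ℝ) +
        s ^ 2 * ((-(2 * c i * (c i * x + d i)) / ((c i * x + d i) ^ 2 + (c i * y) ^ 2) : ℝ) : ℂ)
          ^ 2) * Complex.exp (s * (Real.log y -
            Real.log ((c i * x + d i) ^ 2 + (c i * y) ^ 2) : ℝ))) ∧
    deriv (deriv fun t : ℝ ↦ ∑' i, Complex.exp (s * (Real.log y -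
            Real.log ((c i * t + d i) ^ 2 + (c i * y) ^ 2) : ℝ))) x =
      ∑' i, (s * (-(2 * c i ^ 2) / ((c i * x + d i) ^ 2 + (c i * y) ^ 2) +
        (2 * c i * (c i * x + d i)) ^ 2 / ((c i * x + d i) ^ 2 + (c i * y) ^ 2) ^ 2 : ℝ) +
        s ^ 2 * ((-(2 * c i * (c i * x + d i)) / ((c i * x + d i) ^ 2 + (c i * y) ^ 2) : ℝ) : ℂ)
          ^ 2) * Complex.exp (s * (Real.log y -
            Real.log ((c i * x + d i) ^ 2 + (c i * y) ^ 2) : ℝ)) := by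
  have hQ := fun i t ↦ sq_add_sq_pos_of_ne_zero (hcd i) t hy
  have hQ' : ∀ i t, HasDerivAt (fun t ↦ (c i * t + d i) ^ 2 + (c i * y) ^ 2)
      (2 * c i * (c i * t + d i)) t := fun i t ↦ by
    convert! ((((hasDerivAt_id t).const_mul (c i)).add_const (d i)).pow 2).add_const _ using 1
    simp; ring
  have hl : ∀ i t, HasDerivAt (fun t ↦ 2 * c i * (c i * t + d i)) (2 * c i ^ 2) t := fun i t ↦ by
    convert! (((hasDerivAt_id t).const_mul (c i)).add_const (d i)).const_mul (2 * c i) using 1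
    simp; ring
  have hbd : ∀ i t, |2 * c i * (c i * t + d i) / ((c i * t + d i) ^ 2 + (c i * y) ^ 2)| ≤ 1 / y :=
    fun i t ↦ by
      rw [abs_div, abs_of_pos (hQ i t), div_le_div_iff₀ (hQ i t) hy, ← abs_of_pos hy, ← abs_mul,
        abs_of_pos hy, abs_le]
      constructor <;> nlinarith [sq_nonneg (c i * t + d i + c i * y),
        sq_nonneg (c i * t + d i - c i * y)]
  have hbd2 : ∀ i t, |2 * c i ^ 2 / ((c i * t + d i) ^ 2 + (c i * y) ^ 2)| ≤ 2 / y ^ 2 :=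
    fun i t ↦ by
      have := hQ i t
      rw [abs_of_nonneg (by positivity), div_le_div_iff₀ (hQ i t) (by positivity)]
      nlinarith [sq_nonneg (c i * t + d i)]
  refine deriv_deriv_tsum_cexp (U := Ioo (x - y) (x + y)) (B := 1 / y + 3 / y ^ 2)
    (g := fun i t ↦ Real.log y - Real.log ((c i * t + d i) ^ 2 + (c i * y) ^ 2))
    (g' := fun i t ↦ -(2 * c i * (c i * t + d i)) / ((c i * t + d i) ^ 2 + (c i * y) ^ 2))
    (g'' := fun i t ↦ -(2 * c i ^ 2) / ((c i * t + d i) ^ 2 + (c i * y) ^ 2) +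
        (2 * c i * (c i * t + d i)) ^ 2 / ((c i * t + d i) ^ 2 + (c i * y) ^ 2) ^ 2)
    isOpen_Ioo isPreconnected_Ioo (by constructor <;> linarith) (hsum.mul_left (3 ^ s.re))
    ?_ ?_ ?_ ?_ ?_
  · intro i t _
    convert! ((hQ' i t).log (hQ i t).ne').const_sub (Real.log y) using 1
    ring
  · intro i t _
    have := (hQ i t).ne'
    convert! (hl i t).neg.div (hQ' i t) this using 1
    simp only [Pi.neg_apply]
    field_simp
    ring
  · intro i t _
    rw [neg_div, abs_neg]
    have : 0 ≤ 3 / y ^ 2 := by positivity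
    linarith [hbd i t]
  · intro i t _
    refine (abs_add_le _ _).trans ?_
    rw [neg_div, abs_neg, ← div_pow, abs_pow]
    have h1 := pow_le_pow_left₀ (abs_nonneg _) (hbd i t) 2
    have h2 := hbd2 i t
    have h3 : 0 < 1 / y := by positivity
    have h4 : 3 / y ^ 2 = 2 / y ^ 2 + (1 / y) ^ 2 := by ring
    linarith
  · intro i t ht
    refine exp_mul_log_sub_le hy (hQ i t) hy (hQ i x) (by norm_num) hs ?_
    rw [← mul_div_assoc, div_le_div_iff₀ (hQ i t) (hQ i x)]
    have h1 : (x - t) ^ 2 ≤ y ^ 2 := by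
      apply sq_le_sq'  <;> linarith [ht.1, ht.2]
    have h2 : (c i) ^ 2 * (x - t) ^ 2 ≤ c i ^ 2 * y ^ 2 := by gcongr
    have h3 : (c i * x + d i) ^ 2 + (c i * y) ^ 2 ≤ 3 * ((c i * t + d i) ^ 2 + (c i * y) ^ 2) := by
      nlinarith [sq_nonneg (c i * t + d i - c i * (x - t))]
    nlinarith

theorem deriv_deriv_im_tsum_im (hcd : ∀ i, c i ≠ 0 ∨ d i ≠ 0) (hy : 0 < y) (hs : 0 ≤ s.re)
    (hsum : Summable fun i ↦ (y / ((c i * x + d i) ^ 2 + (c i * y) ^ 2)) ^ s.re) :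
    Summable (fun i ↦ (s * (-(1 / y ^ 2) - 2 * c i ^ 2 / ((c i * x + d i) ^ 2 + (c i * y) ^ 2) +
        (2 * c i ^ 2 * y / ((c i * x + d i) ^ 2 + (c i * y) ^ 2)) ^ 2 : ℝ) +
        s ^ 2 * ((1 / y - 2 * c i ^ 2 * y / ((c i * x + d i) ^ 2 + (c i * y) ^ 2) : ℝ) : ℂ)
          ^ 2) * Complex.exp (s * (Real.log y -
            Real.log ((c i * x + d i) ^ 2 + (c i * y) ^ 2) : ℝ))) ∧
    deriv (deriv fun t : ℝ ↦ ∑' i, Complex.exp (s * (Real.log t -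
            Real.log ((c i * x + d i) ^ 2 + (c i * t) ^ 2) : ℝ))) y =
      ∑' i, (s * (-(1 / y ^ 2) - 2 * c i ^ 2 / ((c i * x + d i) ^ 2 + (c i * y) ^ 2) +
        (2 * c i ^ 2 * y / ((c i * x + d i) ^ 2 + (c i * y) ^ 2)) ^ 2 : ℝ) +
        s ^ 2 * ((1 / y - 2 * c i ^ 2 * y / ((c i * x + d i) ^ 2 + (c i * y) ^ 2) : ℝ) : ℂ)
          ^ 2) * Complex.exp (s * (Real.log y -
            Real.log ((c i * x + d i) ^ 2 + (c i * y) ^ 2) : ℝ)) := by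
  have hU : ∀ t ∈ Ioo (y / 2) (2 * y), 0 < t := fun t ht ↦ by linarith [ht.1]
  have hQ := fun i t (ht : t ∈ Ioo (y / 2) (2 * y)) ↦ sq_add_sq_pos_of_ne_zero (hcd i) x (hU t ht)
  have hyU : y ∈ Ioo (y / 2) (2 * y) := by constructor <;> linarith
  have hQ' : ∀ i t, HasDerivAt (fun t ↦ (c i * x + d i) ^ 2 + (c i * t) ^ 2)
      (2 * c i ^ 2 * t) t := fun i t ↦ by
    convert! (((hasDerivAt_id t).const_mul (c i)).pow 2).const_add _ using 1
    simp; ring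
  have hl : ∀ i t, HasDerivAt (fun t ↦ 2 * c i ^ 2 * t) (2 * c i ^ 2) t := fun i t ↦ by
    simpa using (hasDerivAt_id t).const_mul (2 * c i ^ 2)
  have hinv : ∀ t ∈ Ioo (y / 2) (2 * y), 1 / t ≤ 2 / y := fun t ht ↦ by
    rw [div_le_div_iff₀ (hU t ht) hy]; linarith [ht.1]
  have hbd2 : ∀ i, ∀ t ∈ Ioo (y / 2) (2 * y),
      2 * c i ^ 2 / ((c i * x + d i) ^ 2 + (c i * t) ^ 2) ≤ 2 * (1 / t) ^ 2 := fun i t ht ↦ by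
    have := hU t ht
    rw [one_div, inv_pow, ← div_eq_mul_inv, div_le_div_iff₀ (hQ i t ht) (by positivity)]
    nlinarith [sq_nonneg (c i * x + d i)]
  have hbd : ∀ i, ∀ t ∈ Ioo (y / 2) (2 * y),
      2 * c i ^ 2 * t / ((c i * x + d i) ^ 2 + (c i * t) ^ 2) ≤ 2 * (1 / t) := fun i t ht ↦ by
    have h1 := hU t ht
    have := mul_le_mul_of_nonneg_right (hbd2 i t ht) h1.le
    calc _ = 2 * c i ^ 2 / ((c i * x + d i) ^ 2 + (c i * t) ^ 2) * t := by ring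
      _ ≤ _ := this
      _ = _ := by field_simp
  refine deriv_deriv_tsum_cexp (U := Ioo (y / 2) (2 * y)) (B := 6 / y + 28 / y ^ 2)
    (g := fun i t ↦ Real.log t - Real.log ((c i * x + d i) ^ 2 + (c i * t) ^ 2))
    (g' := fun i t ↦ 1 / t - 2 * c i ^ 2 * t / ((c i * x + d i) ^ 2 + (c i * t) ^ 2))
    (g'' := fun i t ↦ -(1 / t ^ 2) - 2 * c i ^ 2 / ((c i * x + d i) ^ 2 + (c i * t) ^ 2) +
        (2 * c i ^ 2 * t / ((c i * x + d i) ^ 2 + (c i * t) ^ 2)) ^ 2)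
    isOpen_Ioo isPreconnected_Ioo hyU (hsum.mul_left (8 ^ s.re))
    ?_ ?_ ?_ ?_ ?_
  · intro i t ht
    convert! (Real.hasDerivAt_log (hU t ht).ne').sub ((hQ' i t).log (hQ i t ht).ne') using 1
    ring
  · intro i t ht
    have h1 := (hQ i t ht).ne'
    have h2 := (hU t ht).ne'
    have h3 : HasDerivAt (fun t : ℝ ↦ 1 / t) (-(1 / t ^ 2)) t := by
      simpa using hasDerivAt_inv h2
    convert! h3.sub ((hl i t).div (hQ' i t) h1) using 1
    generalize (c i * x + d i) ^ 2 + (c i * t) ^ 2 = q at h1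
    field_simp
    ring
  · intro i t ht
    have h1 := hbd i t ht
    have h2 := hinv t ht
    have h3 := hU t ht
    have h4 := hQ i t ht
    have h5 : 0 < 1 / t := by positivity
    have h6 : 0 ≤ 2 * c i ^ 2 * t / ((c i * x + d i) ^ 2 + (c i * t) ^ 2) := by positivity
    have h7 : 0 ≤ 28 / y ^ 2 := by positivity
    have h8 : 6 / y = 3 * (2 / y) := by ring
    rw [abs_le]; constructor <;> linarith
  · intro i t ht
    have h1 := hbd i t ht
    have h2 := hinv t ht
    have h3 := hU t ht
    have h4 := hQ i t ht
    have h5 : 0 < 1 / t := by positivity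
    have h6 : 0 ≤ 2 * c i ^ 2 * t / ((c i * x + d i) ^ 2 + (c i * t) ^ 2) := by positivity
    have h7 := pow_le_pow_left₀ h6 h1 2
    have h8 := pow_le_pow_left₀ h5.le h2 2
    have h9 := hbd2 i t ht
    have h10 : 28 / y ^ 2 = 7 * (2 / y) ^ 2 := by ring
    have h11 : 0 ≤ 2 * c i ^ 2 / ((c i * x + d i) ^ 2 + (c i * t) ^ 2) := by positivity
    have h12 : 0 < 6 / y := by positivity
    have h13 : 1 / t ^ 2 = (1 / t) ^ 2 := by ring
    rw [abs_le]; constructor <;> nlinarith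
  · intro i t ht
    have h0 := hU t ht
    have h1 := hQ i t ht
    have h2 := hQ i y hyU
    refine exp_mul_log_sub_le h0 h1 hy h2 (by norm_num) hs ?_
    rw [← mul_div_assoc, div_le_div_iff₀ h1 h2]
    have h3 : y ^ 2 ≤ 4 * t ^ 2 := by nlinarith [ht.1]
    have h4 : c i ^ 2 * y ^ 2 ≤ c i ^ 2 * (4 * t ^ 2) := by gcongr
    have h5 : (c i * x + d i) ^ 2 + (c i * y) ^ 2 ≤ 4 * ((c i * x + d i) ^ 2 + (c i * t) ^ 2) := by
      nlinarith [sq_nonneg (c i * x + d i)]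
    calc _ ≤ (2 * y) * (4 * ((c i * x + d i) ^ 2 + (c i * t) ^ 2)) := by
          gcongr; exact ht.2.le
      _ = _ := by ring

/-- The series `∑ (im ((a z + b) / (c z + d)))^s` over a family of lower rows `(c, d)` is an
eigenfunction of the hyperbolic Laplacian, at every point where it converges absolutely. -/
theorem laplace_tsum_im_cpow (hcd : ∀ i, c i ≠ 0 ∨ d i ≠ 0) (hy : 0 < y) (hs : 0 ≤ s.re)
    (hsum : Summable fun i ↦ (y / ((c i * x + d i) ^ 2 + (c i * y) ^ 2)) ^ s.re) :
    (y : ℂ) ^ 2 *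
      (deriv (deriv fun t : ℝ ↦ ∑' i, Complex.exp (s * (Real.log y -
          Real.log ((c i * t + d i) ^ 2 + (c i * y) ^ 2) : ℝ))) x +
        deriv (deriv fun t : ℝ ↦ ∑' i, Complex.exp (s * (Real.log t -
          Real.log ((c i * x + d i) ^ 2 + (c i * t) ^ 2) : ℝ))) y) =
      s * (s - 1) * ∑' i, Complex.exp (s * (Real.log y -
          Real.log ((c i * x + d i) ^ 2 + (c i * y) ^ 2) : ℝ)) := by
  obtain ⟨hs1, h1⟩ := deriv_deriv_re_tsum_im hcd hy hs hsum
  obtain ⟨hs2, h2⟩ := deriv_deriv_im_tsum_im hcd hy hs hsum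
  rw [h1, h2, ← hs1.tsum_add hs2, ← tsum_mul_left, ← tsum_mul_left]
  refine tsum_congr fun i ↦ ?_
  have hQ := sq_add_sq_pos_of_ne_zero (hcd i) x hy
  rw [← add_mul, ← mul_assoc]
  congr 1
  have hy' : (y : ℂ) ≠ 0 := by exact_mod_cast hy.ne'
  have hQ' : ((c i * x + d i) ^ 2 + (c i * y) ^ 2 : ℂ) ≠ 0 := by exact_mod_cast hQ.ne'
  push_cast
  generalize hq : ((c i * x + d i) ^ 2 + (c i * y) ^ 2 : ℂ) = q at hQ'
  generalize (c i * x + d i : ℂ) = a at hq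
  trans s * (s - 1) + (s + s ^ 2) * 4 * c i ^ 2 * y ^ 2 / q ^ 2 * (a ^ 2 + (c i * y) ^ 2 - q)
  · field_simp
    ring
  · rw [hq, sub_self, mul_zero, add_zero]

end PoincareSeries

theorem T_smul_eq_vadd (z : ℍ) : T • z = (1 : ℝ) +ᵥ z := by
  rw [UpperHalfPlane.ext_iff, coe_vadd, add_comm, coe_specialLinearGroup_apply]
  simp [T]

theorem T_zpow_smul_eq_vadd (n : ℤ) (z : ℍ) : T ^ n • z = (n : ℝ) +ᵥ z := by
  induction n with
  | zero => simp
  | succ n ih =>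
    rw [zpow_add_one, (Commute.refl T).zpow_left _ |>.eq, mul_smul, ih, T_smul_eq_vadd, vadd_vadd]
    push_cast
    rw [add_comm]
  | pred n ih =>
    rw [zpow_sub_one, (Commute.refl T).zpow_left _ |>.inv_right.eq, mul_smul, ih,
      inv_smul_eq_iff, T_smul_eq_vadd, vadd_vadd]
    push_cast
    rw [add_sub_cancel]

theorem im_smul_eq_div (g : SL(2, ℝ)) (z : ℍ) :
    (g • z).im = z.im / ((g 1 0 * z.re + g 1 1) ^ 2 + (g 1 0 * z.im) ^ 2) := by
  have h : (g • z).im = z.im / Complex.normSq (g 1 0 * z + g 1 1) := by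
    rw [MulAction.compHom_smul_def, im_smul_eq_div_normSq]
    simp [denom]
  rw [h, Complex.normSq_apply]
  simp [sq]

theorem lower_row_ne_zero (g : SL(2, ℝ)) : g 1 0 ≠ 0 ∨ g 1 1 ≠ 0 := by
  by_contra! h
  have := g.det_coe
  rw [Matrix.det_fin_two, h.1, h.2] at this
  simp at this

/-- Two points of `ℍ` above height `u` and at Euclidean distance at most `k * u` are at hyperbolic
distance at most `k`. -/
theorem UpperHalfPlane.dist_le_of_le_im {z w : ℍ} {u k : ℝ} (hu : 0 < u) (hz : u ≤ z.im)
    (hw : u ≤ w.im) (hd : |z.re - w.re| + |z.im - w.im| ≤ k * u) : dist z w ≤ k := by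
  refine (dist_le_dist_coe_div_sqrt z w).trans ?_
  have h1 : u ≤ √(z.im * w.im) := by
    apply Real.le_sqrt_of_sq_le
    nlinarith
  have h2 : dist (z : ℂ) w ≤ |z.re - w.re| + |z.im - w.im| := by
    rw [Complex.dist_eq]
    simpa using Complex.norm_le_abs_re_add_abs_im ((z : ℂ) - w)
  have h0 : 0 ≤ k := by
    by_contra! h
    nlinarith [abs_nonneg (z.re - w.re), abs_nonneg (z.im - w.im)]
  rw [div_le_iff₀ (hu.trans_le h1)]
  calc _ ≤ k * u := h2.trans hd
    _ ≤ _ := by gcongr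

instance (Γ : Subgroup SL(2, ℝ)) : IsIsometricSMul Γ ℍ :=
  ⟨fun γ ↦ isometry_smul ℍ (γ : SL(2, ℝ))⟩

theorem dist_inv_mul_smul {G X : Type*} [Group G] [PseudoMetricSpace X] [MulAction G X]
    [IsIsometricSMul G X] (g h : G) (x : X) : dist ((g⁻¹ * h) • x) x = dist (h • x) (g • x) := by
  rw [mul_smul, ← dist_smul g, smul_inv_smul]

section Discrete

variable [hΓ : DiscreteTopology Γ]

theorem finite_setOf_dist_smul_le (z : ℍ) (r : ℝ) : {γ : Γ | dist (γ • z) z ≤ r}.Finite := by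
  have : ProperlyDiscontinuousSMul Γ ℍ :=
    @instProperlyDiscontinuousSL2RSubgroup Γ hΓ
  refine (finite_disjoint_inter_image (Γ := Γ) (isCompact_singleton (x := z))
    (isCompact_closedBall z r)).subset fun γ hγ ↦ ?_
  exact ⟨γ • z, ⟨z, rfl, rfl⟩, hγ⟩

theorem im_smul_le_of_discrete (hT : T ∈ Γ) (z : ℍ) :
    ∃ Y : ℝ, 1 ≤ Y ∧ ∀ δ : Γ, (δ • z).im ≤ Y := by
  have hfin := finite_setOf_dist_smul_le Γ z 1
  refine ⟨hfin.toFinset.card + 1, by simp, fun δ ↦ ?_⟩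
  by_contra! h
  let τ : Γ := ⟨T, hT⟩
  have hτ : ∀ (n : ℕ) (w : ℍ), τ ^ n • w = (n : ℝ) +ᵥ w := fun n w ↦ by
    simpa [Subgroup.smul_def, τ] using T_zpow_smul_eq_vadd n w
  have hinj : Function.Injective fun n : ℕ ↦ δ⁻¹ * (τ ^ n * δ) := fun m n hmn ↦ by
    have h1 : τ ^ m = τ ^ n := by simpa using hmn
    have h2 := congrArg (fun g ↦ (g • z).re) h1
    simpa [hτ] using h2
  have hmem : ∀ n ∈ Finset.range (hfin.toFinset.card + 1),
      δ⁻¹ * (τ ^ n * δ) ∈ hfin.toFinset := fun n hn ↦ by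
    rw [Set.Finite.mem_toFinset, Set.mem_ofPred_eq, dist_inv_mul_smul, mul_smul, hτ]
    refine UpperHalfPlane.dist_le_of_le_im (δ • z).im_pos (by simp) le_rfl ?_
    have : (n : ℝ) < hfin.toFinset.card + 1 := by exact_mod_cast Finset.mem_range.mp hn
    simp
    linarith
  have := Finset.card_le_card_of_injOn _ hmem hinj.injOn
  simp at this

end Discrete

theorem mem_Icc_of_floor_log {Y t : ℝ} (ht : 0 < t) (htY : t ≤ Y) :
    Y * Real.exp (-⌊Real.log (Y / t)⌋₊) / Real.exp 1 ≤ t ∧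
      t ≤ Y * Real.exp (-⌊Real.log (Y / t)⌋₊) := by
  have hY := ht.trans_le htY
  have h1 := Nat.floor_le (Real.log_nonneg ((one_le_div ht).mpr htY))
  have h2 := (Nat.lt_floor_add_one (Real.log (Y / t))).le
  generalize (⌊Real.log (Y / t)⌋₊ : ℝ) = m at *
  rw [Real.le_log_iff_exp_le (by positivity), le_div_iff₀ ht] at h1
  rw [Real.log_le_iff_le_exp (by positivity), div_le_iff₀ ht, Real.exp_add] at h2
  rw [Real.exp_neg, ← div_eq_mul_inv, div_div, div_le_iff₀ (by positivity),
    le_div_iff₀ (by positivity)]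
  constructor <;> linarith

/-- The set of points of `ℍ` with `0 ≤ re` and `im ≤ Y` is cut into boxes indexed by `ℕ × ℕ`,
each of hyperbolic diameter at most `6`. -/
def boxIndex (Y : ℝ) (z : ℍ) : ℕ × ℕ :=
  (⌊Real.log (Y / z.im)⌋₊, ⌊z.re * Real.exp ⌊Real.log (Y / z.im)⌋₊⌋₊)

theorem dist_le_of_boxIndex_eq {Y : ℝ} (hY : 1 ≤ Y) {z w : ℍ} (hzY : z.im ≤ Y) (hwY : w.im ≤ Y)
    (hz : 0 ≤ z.re) (hw : 0 ≤ w.re) (h : boxIndex Y z = boxIndex Y w) : dist z w ≤ 6 := by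
  obtain ⟨hm, hb⟩ := Prod.ext_iff.mp h
  simp only [boxIndex] at hm hb
  obtain ⟨hz1, hz2⟩ := mem_Icc_of_floor_log z.im_pos hzY
  obtain ⟨hw1, hw2⟩ := mem_Icc_of_floor_log w.im_pos hwY
  rw [← hm] at hb hw1 hw2
  generalize ⌊Real.log (Y / z.im)⌋₊ = m at *
  set E := Real.exp (-m) with hE
  have hE0 : 0 < E := Real.exp_pos _
  have he : Real.exp 1 ≤ 3 := Real.exp_one_lt_three.le
  have he0 := Real.exp_pos 1
  have hu : Y * E ≤ 3 * (Y * E / Real.exp 1) := by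
    rw [← mul_div_assoc, le_div_iff₀ he0]
    nlinarith [mul_pos (zero_lt_one.trans_le hY) hE0]
  have hu0 : 0 < Y * E / Real.exp 1 := by positivity
  refine UpperHalfPlane.dist_le_of_le_im hu0 hz1 hw1 ?_
  have h1 : |z.re * Real.exp m - w.re * Real.exp m| ≤ 1 := by
    have hz3 := Nat.floor_le (mul_nonneg hz (Real.exp_pos m).le)
    have hz4 := Nat.lt_floor_add_one (z.re * Real.exp m)
    have hw3 := Nat.floor_le (mul_nonneg hw (Real.exp_pos m).le)
    have hw4 := Nat.lt_floor_add_one (w.re * Real.exp m)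
    rw [hb] at hz3 hz4
    rw [abs_le]; constructor <;> linarith
  have h2 : |z.re - w.re| ≤ E := by
    rw [← sub_mul, abs_mul, abs_of_pos (Real.exp_pos _)] at h1
    rw [hE, Real.exp_neg, ← one_div, le_div_iff₀ (Real.exp_pos _)]
    exact h1
  have h3 : |z.im - w.im| ≤ Y * E := by
    rw [abs_le]; constructor <;> linarith [z.im_pos, w.im_pos]
  have h4 : E ≤ Y * E := le_mul_of_one_le_left hE0.le hY
  linarith

theorem im_rpow_le_boxIndex {Y ε : ℝ} {z : ℍ} (hzY : z.im ≤ Y) (hε : 0 ≤ ε)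
    (hz : 0 ≤ z.re) (hz1 : z.re ≤ 1) :
    z.im ^ (1 + 2 * ε) ≤ Y ^ (1 + 2 * ε) * 2 ^ (1 + ε) *
      (Real.exp (-ε) ^ (boxIndex Y z).1 * (((boxIndex Y z).2 + 1 : ℕ) ^ (1 + ε) : ℝ)⁻¹) := by
  obtain ⟨-, h⟩ := mem_Icc_of_floor_log z.im_pos hzY
  have hY := z.im_pos.trans_le hzY
  simp only [boxIndex]
  generalize ⌊Real.log (Y / z.im)⌋₊ = m at *
  have h1 : ((⌊z.re * Real.exp m⌋₊ + 1 : ℕ) : ℝ) ≤ 2 * Real.exp m := by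
    have h2 := Nat.floor_le (mul_nonneg hz (Real.exp_pos m).le)
    have h3 : z.re * Real.exp m ≤ 1 * Real.exp m := by gcongr
    have h4 : 1 ≤ Real.exp m := Real.one_le_exp (by positivity)
    push_cast
    linarith
  generalize ⌊z.re * Real.exp m⌋₊ = b at *
  have h2 : ((b + 1 : ℕ) : ℝ) ^ (1 + ε) ≤ 2 ^ (1 + ε) * Real.exp (m * (1 + ε)) := by
    rw [Real.exp_mul, ← Real.mul_rpow (by norm_num) (Real.exp_pos _).le]
    gcongr
  have h3 : z.im ^ (1 + 2 * ε) ≤ Y ^ (1 + 2 * ε) * Real.exp (-m * (1 + 2 * ε)) := by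
    rw [Real.exp_mul, ← Real.mul_rpow hY.le (Real.exp_pos _).le]
    gcongr
  have hb : (0 : ℝ) < ((b + 1 : ℕ) : ℝ) ^ (1 + ε) := by positivity
  refine h3.trans ?_
  rw [mul_assoc]
  gcongr
  rw [← mul_assoc, ← div_eq_mul_inv, le_div_iff₀ hb, ← Real.exp_nat_mul]
  calc _ ≤ Real.exp (-m * (1 + 2 * ε)) * (2 ^ (1 + ε) * Real.exp (m * (1 + ε))) := by gcongr
    _ = 2 ^ (1 + ε) * (Real.exp (-m * (1 + 2 * ε)) * Real.exp (m * (1 + ε))) := by ring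
    _ = _ := by rw [← Real.exp_add]; ring_nf

theorem summable_boxIndex_weight {ε : ℝ} (hε : 0 < ε) : Summable fun p : ℕ × ℕ ↦
    Real.exp (-ε) ^ p.1 * (((p.2 + 1 : ℕ) ^ (1 + ε) : ℝ)⁻¹) := by
  refine Summable.mul_of_nonneg (f := fun n : ℕ ↦ Real.exp (-ε) ^ n)
    (g := fun n : ℕ ↦ (((n + 1 : ℕ) ^ (1 + ε) : ℝ)⁻¹)) ?_ ?_ ?_ ?_
  · exact summable_geometric_of_lt_one (Real.exp_pos _).le (by simpa using hε)
  · exact (summable_nat_add_iff 1).mpr (Real.summable_nat_rpow_inv.mpr (by linarith))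
  · intro n; positivity
  · intro n; positivity

/-- Absolute convergence of the Eisenstein series of a discrete subgroup. -/
theorem summable_im_rpow [DiscreteTopology Γ] {σ : ℝ} (hσ : 1 < σ) (z : ℍ) :
    Summable fun q : Cosets Γ hT ↦ (((Quotient.out q : Γ) : SL(2, ℝ)) • z).im ^ σ := by
  obtain ⟨Y, hY, hYim⟩ := im_smul_le_of_discrete Γ hT z
  let τ : Γ := ⟨T, hT⟩
  have hτ : ∀ (n : ℤ) (w : ℍ), τ ^ n • w = (n : ℝ) +ᵥ w := fun n w ↦ T_zpow_smul_eq_vadd n w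
  let δ : Cosets Γ hT → Γ := fun q ↦ τ ^ (-⌊((Quotient.out q : Γ) • z).re⌋) * Quotient.out q
  have hδ : ∀ q, δ q • z =
      ((-⌊((Quotient.out q : Γ) • z).re⌋ : ℤ) : ℝ) +ᵥ ((Quotient.out q : Γ) • z) := fun q ↦ by
    rw [mul_smul, hτ]
  have hre : ∀ q, (δ q • z).re = Int.fract ((Quotient.out q : Γ) • z).re := fun q ↦ by
    rw [hδ, vadd_re, Int.fract]
    push_cast
    ring
  have him : ∀ q, (δ q • z).im = (((Quotient.out q : Γ) : SL(2, ℝ)) • z).im := fun q ↦ by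
    rw [hδ, vadd_im, Subgroup.smul_def]
  have hre0 : ∀ q, 0 ≤ (δ q • z).re := fun q ↦ hre q ▸ Int.fract_nonneg _
  have hre1 : ∀ q, (δ q • z).re ≤ 1 := fun q ↦ hre q ▸ (Int.fract_lt_one _).le
  have hδinj : Function.Injective δ := fun p q hpq ↦ by
    rw [← Quotient.out_eq p, ← Quotient.out_eq q]
    refine Quotient.sound (QuotientGroup.rightRel_apply.mpr ?_)
    have hz : ∀ n : ℤ, τ ^ n ∈ GammaInf Γ hT := fun n ↦ zpow_mem (Subgroup.mem_zpowers _) n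
    have h1 : ∀ q, δ q * (Quotient.out q)⁻¹ ∈ GammaInf Γ hT := fun q ↦ by
      simpa [δ] using hz _
    have h2 := mul_mem (inv_mem (h1 q)) (h1 p)
    rw [hpq] at h2
    simpa using h2
  obtain ⟨ε, hε, rfl⟩ : ∃ ε : ℝ, 0 < ε ∧ σ = 1 + 2 * ε := ⟨(σ - 1) / 2, by linarith, by ring⟩
  have : Nonempty (Cosets Γ hT) := ⟨Quotient.mk _ 1⟩
  let Φ : Cosets Γ hT → ℕ × ℕ := fun q ↦ boxIndex Y (δ q • z)
  have hfin := finite_setOf_dist_smul_le Γ z 6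
  have hΦ : ∀ q, Φ (Function.invFun Φ (Φ q)) = Φ q := fun q ↦ Function.invFun_eq ⟨q, rfl⟩
  let Ψ : Cosets Γ hT → (ℕ × ℕ) × {γ : Γ | dist (γ • z) z ≤ 6} := fun q ↦
    (Φ q, ⟨(δ (Function.invFun Φ (Φ q)))⁻¹ * δ q, by
      rw [Set.mem_ofPred_eq, dist_inv_mul_smul]
      exact dist_le_of_boxIndex_eq hY (hYim _) (hYim _) (hre0 _) (hre0 _) (hΦ q).symm⟩)
  have hΨ : Function.Injective Ψ := fun p q hpq ↦ by
    obtain ⟨h1, h2⟩ := Prod.ext_iff.mp hpq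
    have h3 := Subtype.ext_iff.mp h2
    simp only [Ψ] at h1 h3
    rw [h1] at h3
    exact hδinj (mul_left_cancel h3)
  have := hfin.to_subtype
  have hS : Summable fun p : (ℕ × ℕ) × {γ : Γ | dist (γ • z) z ≤ 6} ↦
      (Real.exp (-ε) ^ p.1.1 * (((p.1.2 + 1 : ℕ) ^ (1 + ε) : ℝ)⁻¹)) * 1 :=
    (summable_boxIndex_weight hε).mul_of_nonneg
      (g := fun _ : {γ : Γ | dist (γ • z) z ≤ 6} ↦ (1 : ℝ)) (Summable.of_finite)
      (fun p ↦ by dsimp only [Pi.zero_apply]; positivity) (fun _ ↦ zero_le_one)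
  refine ((hS.comp_injective hΨ).mul_left (Y ^ (1 + 2 * ε) * 2 ^ (1 + ε))).of_nonneg_of_le
    (fun q ↦ Real.rpow_nonneg (UpperHalfPlane.im_pos _).le _) fun q ↦ ?_
  rw [← him, Function.comp_apply, mul_one]
  exact im_rpow_le_boxIndex (hYim _) hε.le (hre0 q) (hre1 q)

/-- Equation (2.3): for a discrete subgroup `Γ` of `SL(2,ℝ)` containing `T` and `Re s > 1`,
the Eisenstein series `F x y = E(x + iy, s)` is summable and satisfies
`y²(F_xx + F_yy) = s(s-1) F`. -/
theorem eisenstein_laplace_eigenfunction [DiscreteTopology Γ]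
    (s : ℂ) (hs : 1 < s.re)
    (F : ℝ → ℝ → ℂ)
    (hF : ∀ (x y : ℝ) (hy : 0 < y),
      F x y = ∑' q : Cosets Γ hT, cEisTerm Γ hT (⟨⟨x, y⟩, hy⟩ : ℍ) s q) :
    ∀ (x y : ℝ) (hy : 0 < y),
      Summable (cEisTerm Γ hT (⟨⟨x, y⟩, hy⟩ : ℍ) s) ∧
        (y : ℂ) ^ 2 *
            (deriv (deriv fun t : ℝ => F t y) x + deriv (deriv fun t : ℝ => F x t) y) =
          s * (s - 1) * F x y := by
  have hcd := fun q : Cosets Γ hT ↦ lower_row_ne_zero ((Quotient.out q : Γ) : SL(2, ℝ))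
  have hF' : ∀ x y : ℝ, 0 < y → F x y = ∑' q : Cosets Γ hT, Complex.exp (s * (Real.log y -
      Real.log ((((Quotient.out q : Γ) : SL(2, ℝ)) 1 0 * x +
        ((Quotient.out q : Γ) : SL(2, ℝ)) 1 1) ^ 2 +
          (((Quotient.out q : Γ) : SL(2, ℝ)) 1 0 * y) ^ 2) : ℝ)) := fun x y hy ↦ by
    rw [hF x y hy]
    refine tsum_congr fun q ↦ ?_
    rw [cEisTerm, im_smul_eq_div]
    exact ofReal_div_cpow_eq_cexp hy (sq_add_sq_pos_of_ne_zero (hcd q) x hy) s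
  intro x y hy
  have hsum := summable_im_rpow Γ hT hs (⟨⟨x, y⟩, hy⟩ : ℍ)
  refine ⟨Summable.of_norm ?_, ?_⟩
  · simpa only [cEisTerm, Complex.norm_cpow_eq_rpow_re_of_pos (UpperHalfPlane.im_pos _)] using hsum
  · simp only [im_smul_eq_div] at hsum
    have hx := funext fun t ↦ hF' t y hy
    have hy' : (fun t ↦ F x t) =ᶠ[𝓝 y] _ :=
      eventually_of_mem (Ioi_mem_nhds hy) fun t ht ↦ hF' x t ht
    rw [hx, hy'.deriv.deriv_eq, hF' x y hy]
    exact laplace_tsum_im_cpow hcd hy (by linarith) hsum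
end
end
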